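/- (Lemma 6.1 of Piterbarg.) Fix n ≥ 1 and 0 < α ≤ 2. Let X be a centered homogeneous Gaussian field on ℝ^n with covariance r satisfying r(t) = 1 − ‖t‖^α + o(‖t‖^α) as ‖t‖ → 0, and let χ_α and H_α be as defined. Then for every nonempty compact set T ⊂ ℝ^n, P(sup_{t ∈ u^{-2/α}T} X(t) > u) = Ψ(u)·H_α(T)·(1 + o(1)) as u → ∞, where u^{-2/α}T = {u^{-2/α} t : t ∈ T}. -/

import Mathlib

open MeasureTheory ProbabilityTheory Real Filter Asymptotics
open scoped Topology NNReal

/-- A family `(X t)_{t ∈ ι}` of real random variables is a Gaussian process: every finite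
real linear combination has a (possibly degenerate) Gaussian distribution. -/
def IsGaussianFamily {Ω : Type*} [MeasurableSpace Ω] (P : Measure Ω)
    {ι : Type*} (X : ι → Ω → ℝ) : Prop :=
  ∀ (N : ℕ) (c : Fin N → ℝ) (ts : Fin N → ι), ∃ (m : ℝ) (v : ℝ≥0),
    Measure.map (fun ω => ∑ i, c i * X (ts i) ω) P = gaussianReal m v

/-- A centered homogeneous Gaussian field on `ℝ^n` with covariance function `r`
(`r 0 = 1`): a Gaussian process with continuous sample paths, mean zero, and
`E[X(t+s)X(s)] = r(t)`. -/
structure IsHomogGaussianField {Ω : Type*} [MeasurableSpace Ω] (P : Measure Ω) {n : ℕ}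
    (X : EuclideanSpace ℝ (Fin n) → Ω → ℝ) (r : EuclideanSpace ℝ (Fin n) → ℝ) : Prop where
  gaussian : IsGaussianFamily P X
  meas : ∀ t, Measurable (X t)
  cont : ∀ ω, Continuous fun t => X t ω
  mean : ∀ t, ∫ ω, X t ω ∂P = 0
  cov : ∀ t s, ∫ ω, X (t + s) ω * X s ω ∂P = r t
  var_one : r 0 = 1

/-- The field `χ_α` on `ℝ^n`: a Gaussian process with continuous sample paths, mean
`E[χ_α(t)] = −‖t‖^α` and covariance `Cov(χ_α(t), χ_α(s)) = ‖t‖^α + ‖s‖^α − ‖t−s‖^α`. -/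
structure IsChiAlpha {Ω' : Type*} [MeasurableSpace Ω'] (P' : Measure Ω') {n : ℕ}
    (α : ℝ) (χ : EuclideanSpace ℝ (Fin n) → Ω' → ℝ) : Prop where
  gaussian : IsGaussianFamily P' χ
  meas : ∀ t, Measurable (χ t)
  cont : ∀ ω, Continuous fun t => χ t ω
  mean : ∀ t, ∫ ω, χ t ω ∂P' = -‖t‖ ^ α
  cov : ∀ t s, (∫ ω, χ t ω * χ s ω ∂P') - (∫ ω, χ t ω ∂P') * (∫ ω, χ s ω ∂P')
      = ‖t‖ ^ α + ‖s‖ ^ α - ‖t - s‖ ^ α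

/-- `H_α(T) = E[exp(sup_{t∈T} χ_α(t))]`. -/
noncomputable def HalphaSet {Ω' : Type*} [MeasurableSpace Ω'] (P' : Measure Ω')
    {n : ℕ} (χ : EuclideanSpace ℝ (Fin n) → Ω' → ℝ)
    (T : Set (EuclideanSpace ℝ (Fin n))) : ℝ :=
  ∫ ω, Real.exp (sSup ((fun t => χ t ω) '' T)) ∂P'

/-- The standard normal density `φ(u) = (2π)^{-1/2} e^{-u²/2}`. -/
noncomputable def stdGaussianPDF (u : ℝ) : ℝ :=
  (2 * Real.pi) ^ (-(1/2) : ℝ) * Real.exp (-u ^ 2 / 2)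

/-- `Ψ(u) = φ(u)/u`. -/
noncomputable def PsiFn (u : ℝ) : ℝ := stdGaussianPDF u / u

/-- A family all of whose finite linear combinations are Gaussian is a Gaussian process. -/
lemma IsGaussianFamily.isGaussianProcess {Ω : Type*} [MeasurableSpace Ω] {P : Measure Ω}
    {ι : Type*} {X : ι → Ω → ℝ} (h : IsGaussianFamily P X) (hm : ∀ t, Measurable (X t)) :
    IsGaussianProcess X P := by
  classical
  refine ⟨fun I => ⟨isGaussian_of_map_eq_gaussianReal fun L => ?_⟩⟩
  obtain ⟨m, v, hmv⟩ := h (Fintype.card I)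
    (fun i => L (Pi.single ((Fintype.equivFin I).symm i) 1))
    (fun i => ((Fintype.equivFin I).symm i : ι))
  refine ⟨m, v, ?_⟩
  have hmeas : Measurable fun ω => I.restrict (X · ω) := measurable_pi_lambda _ fun i => hm _
  rw [← hmv, Measure.map_map (by fun_prop) hmeas]
  congr 1
  ext ω
  rw [(Fintype.equivFin I).symm.sum_comp (fun i => L (Pi.single i 1) * X i ω)]
  have : I.restrict (X · ω) = ∑ i : I, X i ω • Pi.single (M := fun _ => ℝ) i 1 := by
    ext j
    simp [Finset.sum_apply, Pi.single_apply]
  simp only [Function.comp_apply]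
  rw [this, map_sum]
  simp [mul_comm]

/-- Two-term linear combinations of the values of a Gaussian process form a Gaussian process. -/
lemma ProbabilityTheory.IsGaussianProcess.linear_comb_two {Ω T κ : Type*} [MeasurableSpace Ω]
    {P : Measure Ω} {X : T → Ω → ℝ} (hX : IsGaussianProcess X P) (a b : κ → T) (c d : κ → ℝ) :
    IsGaussianProcess (fun k ω => c k * X (a k) ω + d k * X (b k) ω) P := by
  classical
  refine hX.of_isGaussianProcess fun k => ⟨{a k, b k},
    c k • ContinuousLinearMap.proj (R := ℝ) (φ := fun _ => ℝ)
      (⟨a k, by simp⟩ : ({a k, b k} : Finset T)) +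
    d k • ContinuousLinearMap.proj (R := ℝ) (φ := fun _ => ℝ)
      (⟨b k, by simp⟩ : ({a k, b k} : Finset T)), fun ω => ?_⟩
  simp

/-- A Gaussian vector has the multivariate Gaussian law with its mean and covariance matrix. -/
lemma ProbabilityTheory.HasGaussianLaw.map_toLp_eq_multivariateGaussian {Ω ι : Type*}
    [MeasurableSpace Ω] {P : Measure Ω} [IsProbabilityMeasure P] [Fintype ι] [DecidableEq ι]
    {V : ι → Ω → ℝ} (hV : HasGaussianLaw (fun ω i => V i ω) P) {m : ι → ℝ} {S : Matrix ι ι ℝ}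
    (hm : ∀ i, ∫ ω, V i ω ∂P = m i) (hS : ∀ i j, cov[V i, V j; P] = S i j) :
    S.PosSemidef ∧
      P.map (fun ω => WithLp.toLp 2 fun i => V i ω) = multivariateGaussian (WithLp.toLp 2 m) S := by
  have hL2 : ∀ i, MemLp (V i) 2 P := fun i => (hV.eval i).memLp_two
  have hb : ∀ x y : EuclideanSpace ℝ ι,
      covarianceBilin (P.map (fun ω => WithLp.toLp 2 fun i => V i ω)) x y =
        ∑ i, ∑ j, x i * y j * S i j := by
    intro x y
    rw [covarianceBilin_apply_pi hL2]
    simp only [hS]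
  have hpsd : S.PosSemidef := by
    refine Matrix.PosSemidef.of_dotProduct_mulVec_nonneg ?_ fun x => ?_
    · ext i j
      simp [Matrix.conjTranspose_apply, ← hS, covariance_comm]
    · have := covarianceBilin_self_nonneg (μ := P.map (fun ω => WithLp.toLp 2 fun i => V i ω))
        (WithLp.toLp 2 x)
      rw [hb] at this
      refine this.trans_eq ?_
      simp only [dotProduct, Matrix.mulVec, Finset.mul_sum, star_trivial]
      refine Finset.sum_congr rfl fun i _ => Finset.sum_congr rfl fun j _ => by ring
  refine ⟨hpsd, ?_⟩
  have hG : IsGaussian (P.map (fun ω => WithLp.toLp 2 fun i => V i ω)) :=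
    (hV.toLp_pi 2).isGaussian_map
  have hmeas : AEMeasurable (fun ω => WithLp.toLp 2 fun i => V i ω) P :=
    (hV.toLp_pi 2).aemeasurable
  refine IsGaussian.ext ?_ ?_
  · rw [integral_id_multivariateGaussian']
    rw [integral_map hmeas (by fun_prop)]
    ext i
    change _ = m i
    rw [← hm i]
    simp only [id]
    have := (EuclideanSpace.proj (𝕜 := ℝ) i : EuclideanSpace ℝ ι →L[ℝ] ℝ).integral_comp_comm
      (hV.toLp_pi 2).integrable
    simpa using this.symm
  · ext x y
    rw [hb, covarianceBilin_multivariateGaussian hpsd]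
    simp only [dotProduct, Matrix.mulVec, Finset.mul_sum]
    refine Finset.sum_congr rfl fun i _ => Finset.sum_congr rfl fun j _ => by ring

/-- Chernoff bound for a centered Gaussian variable. -/
lemma ProbabilityTheory.HasGaussianLaw.measure_le_neg_le {Ω : Type*}
    [MeasurableSpace Ω] {P : Measure Ω} [IsProbabilityMeasure P] {Y : Ω → ℝ}
    (hY : HasGaussianLaw Y P) (h0 : ∫ ω, Y ω ∂P = 0) {v : ℝ} (hv0 : 0 ≤ v)
    (hv : Var[Y; P] ≤ v) {x : ℝ} (hx : 0 ≤ x) :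
    P.real {ω | Y ω ≤ -x} ≤ Real.exp (-x ^ 2 / (2 * v)) := by
  have hmap := hY.map_eq_gaussianReal
  rw [h0] at hmap
  have hsub : HasSubgaussianMGF Y v.toNNReal P := by
    refine ⟨fun t => ?_, fun t => ?_⟩
    · have := integrable_exp_mul_gaussianReal (μ := 0) (v := (Var[Y; P]).toNNReal) t
      rw [← hmap] at this
      exact this.comp_aemeasurable hY.aemeasurable
    · rw [mgf_gaussianReal hmap, zero_mul, zero_add]
      gcongr
  have := hsub.neg.measure_ge_le hx
  simpa [le_neg, Real.coe_toNNReal _ hv0] using this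

/-- The ratio `P(N(0,1) > u - y/u) / Ψ(u)`, written as an integral. -/
noncomputable def tiltedTail (u y : ℝ) : ℝ :=
  ∫ w in Set.Iio y, Real.exp (w - w ^ 2 / (2 * u ^ 2))

lemma PsiFn_pos {u : ℝ} (hu : 0 < u) : 0 < PsiFn u := by
  unfold PsiFn stdGaussianPDF; positivity

lemma gaussianReal_Ioi_eq_PsiFn_mul_tiltedTail {u : ℝ} (hu : 0 < u) (y : ℝ) :
    (gaussianReal 0 1).real (Set.Ioi (u - y / u)) = PsiFn u * tiltedTail u y := by
  rw [measureReal_def, gaussianReal_apply_eq_integral _ one_ne_zero, ENNReal.toReal_ofReal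
    (setIntegral_nonneg measurableSet_Ioi fun x _ => gaussianPDFReal_nonneg _ _ _),
    ← integral_indicator measurableSet_Ioi]
  set g : ℝ → ℝ := (Set.Ioi (u - y / u)).indicator (gaussianPDFReal 0 1) with hg
  have h1 := Measure.integral_comp_div (fun x => g (u - x)) u
  rw [integral_sub_left_eq_self g volume u, abs_of_pos hu, smul_eq_mul] at h1
  have h2 : ∀ w, g (u - w / u) = (Set.Iio y).indicator
      (fun w => stdGaussianPDF u * Real.exp (w - w ^ 2 / (2 * u ^ 2))) w := by
    intro w
    have hiff : u - w / u ∈ Set.Ioi (u - y / u) ↔ w ∈ Set.Iio y := by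
      simp [div_lt_div_iff_of_pos_right hu]
    by_cases hw : w ∈ Set.Iio y
    · rw [hg, Set.indicator_of_mem hw, Set.indicator_of_mem (hiff.2 hw)]
      simp only [gaussianPDFReal, stdGaussianPDF, NNReal.coe_one, mul_one, sub_zero]
      rw [mul_assoc, ← Real.exp_add, Real.sqrt_eq_rpow, ← Real.rpow_neg (by positivity)]
      congr 2
      field_simp
      ring
    · rw [hg, Set.indicator_of_notMem hw, Set.indicator_of_notMem (mt hiff.1 hw)]
  simp_rw [h2] at h1
  rw [integral_indicator measurableSet_Iio, integral_const_mul] at h1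
  rw [PsiFn, tiltedTail, div_mul_eq_mul_div, h1]
  field_simp

lemma tiltedTail_nonneg (u y : ℝ) : 0 ≤ tiltedTail u y :=
  setIntegral_nonneg measurableSet_Iio fun _ _ => (Real.exp_pos _).le

lemma integrableOn_exp_Iio (y : ℝ) : IntegrableOn Real.exp (Set.Iio y) :=
  (integrableOn_exp_Iic y).mono_set Set.Iio_subset_Iic_self

lemma integral_exp_Iio (y : ℝ) : ∫ w in Set.Iio y, Real.exp w = Real.exp y := by
  rw [setIntegral_congr_set Iio_ae_eq_Iic, integral_exp_Iic]

lemma tiltedTail_le_exp (u y : ℝ) : tiltedTail u y ≤ Real.exp y := by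
  rw [← integral_exp_Iio y, tiltedTail]
  refine integral_mono_of_nonneg (.of_forall fun _ => (Real.exp_pos _).le)
    (integrableOn_exp_Iio y) (.of_forall fun w => ?_)
  simp only [Real.exp_le_exp, sub_le_self_iff]
  positivity

lemma tendsto_tiltedTail {y : ℝ → ℝ} {y₀ : ℝ} (hy : Tendsto y atTop (𝓝 y₀)) :
    Tendsto (fun u => tiltedTail u (y u)) atTop (𝓝 (Real.exp y₀)) := by
  rw [← integral_exp_Iio y₀, ← integral_indicator measurableSet_Iio]
  simp_rw [tiltedTail, ← integral_indicator measurableSet_Iio]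
  refine tendsto_integral_filter_of_dominated_convergence
    ((Set.Iio (y₀ + 1)).indicator Real.exp) (.of_forall fun u => ?_) ?_
    ((integrableOn_exp_Iio _).integrable_indicator measurableSet_Iio) ?_
  · exact (Measurable.indicator (by fun_prop) measurableSet_Iio).aestronglyMeasurable
  · filter_upwards [hy.eventually_lt_const (lt_add_one y₀)] with u hu
    refine .of_forall fun w => ?_
    by_cases hw : w ∈ Set.Iio (y u)
    · have hw' : w ∈ Set.Iio (y₀ + 1) := lt_trans (Set.mem_Iio.1 hw) hu
      rw [Set.indicator_of_mem hw, Set.indicator_of_mem hw', Real.norm_of_nonneg (Real.exp_pos _).le]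
      simp only [Real.exp_le_exp, sub_le_self_iff]
      positivity
    · rw [Set.indicator_of_notMem hw, norm_zero]
      exact Set.indicator_nonneg (fun _ _ => (Real.exp_pos _).le) _
  · filter_upwards [compl_mem_ae_iff.2 (measure_singleton (μ := (volume : Measure ℝ)) y₀)] with w hw
    have hlim : Tendsto (fun u : ℝ => Real.exp (w - w ^ 2 / (2 * u ^ 2))) atTop
        (𝓝 (Real.exp w)) := by
      have : Tendsto (fun u : ℝ => w - w ^ 2 / (2 * u ^ 2)) atTop (𝓝 (w - 0)) :=
        tendsto_const_nhds.sub (tendsto_const_nhds.div_atTop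
          ((tendsto_pow_atTop two_ne_zero).const_mul_atTop two_pos))
      rw [sub_zero] at this
      exact (Real.continuous_exp.tendsto _).comp this
    rcases lt_or_gt_of_ne hw with h | h
    · rw [Set.indicator_of_mem (by exact h)]
      refine hlim.congr' ?_
      filter_upwards [hy.eventually_const_lt h] with u hu
      rw [Set.indicator_of_mem (by exact hu)]
    · rw [Set.indicator_of_notMem (by simpa using h.le)]
      refine tendsto_const_nhds.congr' ?_
      filter_upwards [hy.eventually_lt_const h] with u hu
      rw [Set.indicator_of_notMem (by simpa using hu.le)]

lemma measurable_tiltedTail (u : ℝ) : Measurable (tiltedTail u) := by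
  refine Monotone.measurable fun a b hab => ?_
  refine setIntegral_mono_set ?_ (.of_forall fun _ => (Real.exp_pos _).le)
    (Set.Iio_subset_Iio hab).eventuallyLE
  refine (integrableOn_exp_Iio b).mono' (by fun_prop) (.of_forall fun w => ?_)
  rw [Real.norm_of_nonneg (Real.exp_pos _).le]
  simp only [Real.exp_le_exp, sub_le_self_iff]
  positivity

lemma Finset.measurable_univ_sup' {Ω ι : Type*} [MeasurableSpace Ω] [Fintype ι] [Nonempty ι]
    {f : ι → Ω → ℝ} (hf : ∀ i, Measurable (f i)) :
    Measurable fun ω => Finset.univ.sup' Finset.univ_nonempty fun i => f i ω := by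
  have : (fun ω => Finset.univ.sup' Finset.univ_nonempty fun i => f i ω) =
      Finset.univ.sup' Finset.univ_nonempty f := by
    ext ω; simp [Finset.sup'_apply]
  rw [this]
  exact Finset.measurable_sup' _ fun i _ => hf i

/-- Exceedance probability of the maximum of finitely many variables `ρ i * Z + Y i`, where `Z` is
standard Gaussian and independent of the vector `Y`. -/
lemma measureReal_exists_lt_mul_add_eq {Ω ι : Type*} [MeasurableSpace Ω] {P : Measure Ω}
    [IsProbabilityMeasure P] [Fintype ι] [Nonempty ι] {Z : Ω → ℝ} {Y : ι → Ω → ℝ}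
    (hZm : Measurable Z) (hYm : ∀ i, Measurable (Y i)) (hZ : P.map Z = gaussianReal 0 1)
    (hind : IndepFun Z (fun ω i => Y i ω) P) {ρ : ι → ℝ} (hρ : ∀ i, 0 < ρ i) {u : ℝ} (hu : 0 < u)
    (δ : ℝ) :
    P.real {ω | ∃ i, u - δ / u < ρ i * Z ω + Y i ω} =
      PsiFn u * ∫ ω, tiltedTail u (Finset.univ.sup' Finset.univ_nonempty
        fun i => (u * Y i ω - u ^ 2 * (1 - ρ i) + δ) / ρ i) ∂P := by
  set M : (ι → ℝ) → ℝ := fun y => Finset.univ.sup' Finset.univ_nonempty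
        fun i => (u * y i - u ^ 2 * (1 - ρ i) + δ) / ρ i with hM
  have hMm : Measurable M := Finset.measurable_univ_sup' fun i => by fun_prop
  have hYm' : Measurable fun ω i => Y i ω := measurable_pi_lambda _ hYm
  set S : Set ((ι → ℝ) × ℝ) := {p | ∃ i, u - δ / u < ρ i * p.2 + p.1 i} with hS
  have hSm : MeasurableSet S := by
    rw [hS, Set.ofPred_exists]
    exact .iUnion fun i => measurableSet_lt (by fun_prop) (by fun_prop)
  have hsec : ∀ y : ι → ℝ, Prod.mk y ⁻¹' S = Set.Ioi (u - M y / u) := by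
    intro y
    ext z
    simp only [hS, Set.mem_preimage, Set.mem_ofPred_eq, Set.mem_Ioi]
    rw [sub_lt_comm, lt_div_iff₀ hu, hM, Finset.lt_sup'_iff]
    simp only [Finset.mem_univ, true_and]
    refine exists_congr fun i => ?_
    rw [lt_div_iff₀ (hρ i), sub_lt_iff_lt_add, ← sub_lt_iff_lt_add', lt_div_iff₀ hu]
    constructor <;> intro h <;> nlinarith
  have hmap : P.map (fun ω => ((fun i => Y i ω), Z ω)) =
      (P.map fun ω i => Y i ω).prod (gaussianReal 0 1) := by
    rw [← hZ]
    exact (indepFun_iff_map_prod_eq_prod_map_map hYm'.aemeasurable hZm.aemeasurable).1 hind.symm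
  have hev : P {ω | ∃ i, u - δ / u < ρ i * Z ω + Y i ω} =
      ∫⁻ ω, ENNReal.ofReal (PsiFn u * tiltedTail u (M fun i => Y i ω)) ∂P := by
    change P ((fun ω => ((fun i => Y i ω), Z ω)) ⁻¹' S) = _
    rw [← Measure.map_apply (hYm'.prodMk hZm) hSm, hmap, Measure.prod_apply hSm]
    have : ∀ y, gaussianReal 0 1 (Prod.mk y ⁻¹' S) =
        ENNReal.ofReal (PsiFn u * tiltedTail u (M y)) := by
      intro y
      rw [hsec, ← gaussianReal_Ioi_eq_PsiFn_mul_tiltedTail hu, ofReal_measureReal]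
    simp_rw [this]
    rw [lintegral_map _ hYm']
    exact (((measurable_tiltedTail u).comp hMm).const_mul _).ennreal_ofReal
  rw [measureReal_def, hev, ← integral_const_mul, integral_eq_lintegral_of_nonneg_ae]
  · exact .of_forall fun ω => mul_nonneg (PsiFn_pos hu).le (tiltedTail_nonneg _ _)
  · exact (((measurable_tiltedTail u).comp (hMm.comp hYm')).const_mul _).aestronglyMeasurable

namespace IsHomogGaussianField

variable {Ω : Type*} [MeasurableSpace Ω] {P : Measure Ω} {n : ℕ}
  {X : EuclideanSpace ℝ (Fin n) → Ω → ℝ} {r : EuclideanSpace ℝ (Fin n) → ℝ}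

lemma isGaussianProcess (hX : IsHomogGaussianField P X r) : IsGaussianProcess X P :=
  hX.gaussian.isGaussianProcess hX.meas

lemma memLp_two (hX : IsHomogGaussianField P X r) (t : EuclideanSpace ℝ (Fin n)) :
    MemLp (X t) 2 P :=
  (hX.isGaussianProcess.hasGaussianLaw_eval t).memLp_two

variable [IsProbabilityMeasure P]

lemma covariance_eq (hX : IsHomogGaussianField P X r) (s t : EuclideanSpace ℝ (Fin n)) :
    cov[X s, X t; P] = r (s - t) := by
  rw [covariance_eq_sub (hX.memLp_two s) (hX.memLp_two t), hX.mean, hX.mean, ← hX.cov (s - t) t]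
  simp

lemma symm (hX : IsHomogGaussianField P X r) (s t : EuclideanSpace ℝ (Fin n)) :
    r (s - t) = r (t - s) := by
  rw [← hX.covariance_eq, ← hX.covariance_eq, covariance_comm]

lemma variance_eq (hX : IsHomogGaussianField P X r) (t : EuclideanSpace ℝ (Fin n)) :
    Var[X t; P] = 1 := by
  rw [← covariance_self (hX.meas t).aemeasurable, hX.covariance_eq, sub_self, hX.var_one]

lemma map_eq (hX : IsHomogGaussianField P X r) (t : EuclideanSpace ℝ (Fin n)) :
    P.map (X t) = gaussianReal 0 1 := by
  rw [(hX.isGaussianProcess.hasGaussianLaw_eval t).map_eq_gaussianReal, hX.mean, hX.variance_eq]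
  simp

lemma le_one (hX : IsHomogGaussianField P X r) (t : EuclideanSpace ℝ (Fin n)) : r t ≤ 1 := by
  have h := variance_nonneg (X t - X 0) P
  rw [variance_sub (hX.memLp_two _) (hX.memLp_two _), hX.variance_eq, hX.variance_eq,
    hX.covariance_eq, sub_zero] at h
  linarith

/-- The covariance of the residuals after regressing on the value at `p`. -/
lemma covariance_residual (hX : IsHomogGaussianField P X r) (p s t : EuclideanSpace ℝ (Fin n))
    (a b : ℝ) :
    cov[fun ω => 1 * X s ω + a * X p ω, fun ω => 1 * X t ω + b * X p ω; P] =
      r (s - t) + b * r (s - p) + a * r (t - p) + a * b := by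
  have hL := hX.memLp_two
  change cov[(fun ω => 1 * X s ω) + fun ω => a * X p ω,
    (fun ω => 1 * X t ω) + fun ω => b * X p ω; P] = _
  rw [covariance_add_left ((hL s).const_mul 1) ((hL p).const_mul a)
      (((hL t).const_mul 1).add ((hL p).const_mul b)),
    covariance_add_right ((hL s).const_mul 1) ((hL t).const_mul 1) ((hL p).const_mul b),
    covariance_add_right ((hL p).const_mul a) ((hL t).const_mul 1) ((hL p).const_mul b)]
  simp only [covariance_const_mul_left, covariance_const_mul_right, hX.covariance_eq, sub_self,
    hX.var_one, hX.symm p t]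
  ring

lemma measureReal_lt (hX : IsHomogGaussianField P X r) (t : EuclideanSpace ℝ (Fin n)) {u : ℝ}
    (hu : 0 < u) (y : ℝ) :
    P.real {ω | u - y / u < X t ω} = PsiFn u * tiltedTail u y := by
  rw [← gaussianReal_Ioi_eq_PsiFn_mul_tiltedTail hu, ← hX.map_eq t,
    map_measureReal_apply (hX.meas t) measurableSet_Ioi]
  rfl

/-- The residuals after regressing on the value at `p` are independent of that value. -/
lemma indepFun_residual (hX : IsHomogGaussianField P X r) {ι : Type*}
    (p : EuclideanSpace ℝ (Fin n)) (x : ι → EuclideanSpace ℝ (Fin n)) :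
    IndepFun (X p) (fun ω i => 1 * X (x i) ω + -r (x i - p) * X p ω) P := by
  have hG : IsGaussianProcess (Sum.elim (fun _ : Unit => X p)
      fun i ω => 1 * X (x i) ω + -r (x i - p) * X p ω) P := by
    convert hX.isGaussianProcess.linear_comb_two (κ := Unit ⊕ ι) (Sum.elim (fun _ => p) x)
      (fun _ => p) (fun _ => 1) (Sum.elim (fun _ => 0) fun i => -r (x i - p)) using 1
    ext k ω
    rcases k with k | k <;> simp
  have hind := hG.indepFun_of_covariance_eq_zero (fun _ => (hX.meas p).aemeasurable)
    (fun i => (((hX.meas _).const_mul _).add ((hX.meas _).const_mul _)).aemeasurable)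
    (fun _ i => by
      have h := hX.covariance_residual p p (x i) 0 (-r (x i - p))
      simp only [one_mul, zero_mul, add_zero, sub_self, hX.var_one, hX.symm p] at h ⊢
      rw [h]; ring)
  exact hind.comp (φ := fun z : Unit → ℝ => z ()) (ψ := id) (measurable_pi_apply _) measurable_id

/-- The probability of a large downward increment, starting from a high level. -/
lemma measureReal_increment_le (hX : IsHomogGaussianField P X r)
    (s t : EuclideanSpace ℝ (Fin n)) {u a b κ : ℝ} (hu : 0 < u) (hb : 0 ≤ b)
    (hr : 0 ≤ r (s - t)) (hκ : u ^ 2 * (1 - r (s - t)) ≤ κ) (hκd : κ ≤ (a - b) / 2) :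
    P.real {ω | X s ω ≤ u - a / u ∧ u - b / u < X t ω} ≤
      PsiFn u * (Real.exp b * Real.exp (-(a - b) ^ 2 / (16 * κ))) := by
  have hr1 := hX.le_one (s - t)
  have hκ0 : 0 ≤ κ := le_trans (mul_nonneg (sq_nonneg u) (by linarith)) hκ
  set Y : Ω → ℝ := fun ω => 1 * X s ω + -r (s - t) * X t ω with hY
  have hYm : Measurable Y := ((hX.meas _).const_mul _).add ((hX.meas _).const_mul _)
  have hind : IndepFun (X t) Y P :=
    (hX.indepFun_residual t (fun _ : Unit => s)).comp (φ := id)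
      (ψ := fun z : Unit → ℝ => z ()) measurable_id (measurable_pi_apply _)
  have hYG : HasGaussianLaw Y P :=
    (hX.isGaussianProcess.linear_comb_two (κ := Unit) (fun _ => s) (fun _ => t) (fun _ => 1)
      (fun _ => -r (s - t))).hasGaussianLaw_eval ()
  have hY0 : ∫ ω, Y ω ∂P = 0 := by
    rw [hY, integral_add (((hX.memLp_two _).integrable one_le_two).const_mul _)
      (((hX.memLp_two _).integrable one_le_two).const_mul _), integral_const_mul,
      integral_const_mul, hX.mean, hX.mean]
    simp
  have hYv : Var[Y; P] ≤ 2 * κ / u ^ 2 := by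
    rw [← covariance_self hYm.aemeasurable, hY, hX.covariance_residual, sub_self, hX.var_one,
      le_div_iff₀ (by positivity)]
    nlinarith [sq_nonneg u, mul_nonneg (sq_nonneg u) (sub_nonneg.2 hr1)]
  have hd : 0 ≤ a - b := by linarith
  have hsub : {ω | X s ω ≤ u - a / u ∧ u - b / u < X t ω} ⊆
      X t ⁻¹' Set.Ioi (u - b / u) ∩ Y ⁻¹' Set.Iic (-((a - b) / (2 * u))) := by
    rintro ω ⟨h1, h2⟩
    refine ⟨h2, ?_⟩
    simp only [Set.mem_preimage, Set.mem_Iic, hY, one_mul]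
    have h3 : r (s - t) * (u - b / u) ≤ r (s - t) * X t ω := mul_le_mul_of_nonneg_left h2.le hr
    have h4 : u - a / u - r (s - t) * (u - b / u) ≤ -((a - b) / (2 * u)) := by
      have : u - a / u - r (s - t) * (u - b / u) =
        (u ^ 2 * (1 - r (s - t)) - a + r (s - t) * b) / u := by field_simp; ring
      rw [this, ← neg_div, div_le_div_iff₀ hu (by positivity)]
      have h5 : r (s - t) * b ≤ b := mul_le_of_le_one_left hb hr1
      have h6 : u ^ 2 * (1 - r (s - t)) - a + r (s - t) * b ≤ -(a - b) / 2 := by linarith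
      calc _ ≤ -(a - b) / 2 * (2 * u) := mul_le_mul_of_nonneg_right h6 (by positivity)
        _ = _ := by ring
    linarith
  calc P.real {ω | X s ω ≤ u - a / u ∧ u - b / u < X t ω}
      ≤ P.real (X t ⁻¹' Set.Ioi (u - b / u) ∩ Y ⁻¹' Set.Iic (-((a - b) / (2 * u)))) :=
        measureReal_mono hsub
    _ = P.real (X t ⁻¹' Set.Ioi (u - b / u)) * P.real (Y ⁻¹' Set.Iic (-((a - b) / (2 * u)))) := by
        simp only [measureReal_def]
        rw [hind.measure_inter_preimage_eq_mul _ _ measurableSet_Ioi measurableSet_Iic,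
          ENNReal.toReal_mul]
    _ ≤ (PsiFn u * Real.exp b) * Real.exp (-(a - b) ^ 2 / (16 * κ)) := by
        gcongr
        · exact mul_nonneg (PsiFn_pos hu).le (Real.exp_pos _).le
        · exact (hX.measureReal_lt t hu b).trans_le
            (mul_le_mul_of_nonneg_left (tiltedTail_le_exp _ _) (PsiFn_pos hu).le)
        · refine (hYG.measure_le_neg_le hY0 (v := 2 * κ / u ^ 2) (by positivity) hYv
            (x := (a - b) / (2 * u)) (by positivity)).trans_eq ?_
          congr 1
          rcases hκ0.eq_or_lt with rfl | hκ'
          · simp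
          · field_simp
            ring
    _ = _ := by ring

end IsHomogGaussianField

section SqrtContinuity

open scoped MatrixOrder

open scoped Matrix.Norms.L2Operator in
lemma tendsto_sqrt_apply_of_posSemidef {ι β : Type*} [Fintype ι] [DecidableEq ι] {l : Filter β}
    {S : β → Matrix ι ι ℝ} {S₀ : Matrix ι ι ℝ} (hS : ∀ᶠ u in l, (S u).PosSemidef)
    (hS₀ : S₀.PosSemidef) (h : ∀ i j, Tendsto (fun u => S u i j) l (𝓝 (S₀ i j))) (i j : ι) :
    Tendsto (fun u => CFC.sqrt (S u) i j) l (𝓝 (CFC.sqrt S₀ i j)) := by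
  have hlim : Tendsto S l (𝓝[{A | 0 ≤ A}] S₀) := by
    refine tendsto_nhdsWithin_iff.2 ⟨?_, hS.mono fun u hu => hu.nonneg⟩
    exact tendsto_pi_nhds.2 fun i => tendsto_pi_nhds.2 fun j => h i j
  have hc := (CFC.continuousOn_sqrt (A := Matrix ι ι ℝ) S₀ hS₀.nonneg).tendsto.comp hlim
  exact tendsto_pi_nhds.1 (tendsto_pi_nhds.1 hc i) j

lemma ProbabilityTheory.IsGaussian.integrable_exp_mul_norm {E : Type*} [NormedAddCommGroup E]
    [NormedSpace ℝ E] [MeasurableSpace E] [BorelSpace E] [SecondCountableTopology E]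
    [CompleteSpace E] (μ : Measure E) [IsGaussian μ] (a : ℝ) :
    Integrable (fun x => Real.exp (a * ‖x‖)) μ := by
  obtain ⟨C, hC, hInt⟩ := IsGaussian.exists_integrable_exp_sq μ
  refine (hInt.const_mul (Real.exp (a ^ 2 / (4 * C)))).mono' (by fun_prop) (.of_forall fun x => ?_)
  rw [Real.norm_of_nonneg (Real.exp_pos _).le, ← Real.exp_add, Real.exp_le_exp,
    ← sub_nonneg]
  have : a ^ 2 / (4 * C) + C * ‖x‖ ^ 2 - a * ‖x‖ = (2 * C * ‖x‖ - a) ^ 2 / (4 * C) := by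
    field_simp; ring
  rw [this]; positivity

/-- Convergence of the tilted tails of the maximum of a Gaussian vector, when its mean and
covariance matrix converge. -/
lemma tendsto_integral_tiltedTail_sup {ι : Type*} [Fintype ι] [Nonempty ι] [DecidableEq ι]
    {S : ℝ → Matrix ι ι ℝ} {S₀ : Matrix ι ι ℝ} (hS : ∀ᶠ u in atTop, (S u).PosSemidef)
    (hS₀ : S₀.PosSemidef) (hlim : ∀ i j, Tendsto (fun u => S u i j) atTop (𝓝 (S₀ i j)))
    {m ρ : ℝ → ι → ℝ} {m₀ : ι → ℝ} (hm : ∀ i, Tendsto (fun u => m u i) atTop (𝓝 (m₀ i)))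
    (hρ : ∀ i, Tendsto (fun u => ρ u i) atTop (𝓝 1)) :
    Tendsto (fun u => ∫ x, tiltedTail u (Finset.univ.sup' Finset.univ_nonempty
        fun i => (x i + m u i) / ρ u i) ∂(multivariateGaussian 0 (S u))) atTop
      (𝓝 (∫ x, Real.exp (Finset.univ.sup' Finset.univ_nonempty
        fun i => x i + m₀ i) ∂(multivariateGaussian 0 S₀))) := by
  have hsq := tendsto_sqrt_apply_of_posSemidef hS hS₀ hlim
  have happ : ∀ (A : Matrix ι ι ℝ) (x : EuclideanSpace ℝ ι) (i : ι),
      ((0 : EuclideanSpace ℝ ι) + Matrix.toEuclideanCLM (𝕜 := ℝ) A x) i = ∑ j, A i j * x j := by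
    intro A x i
    simp [Matrix.mulVec, dotProduct]
  simp_rw [multivariateGaussian]
  have h1 : ∀ u, ∫ x, tiltedTail u (Finset.univ.sup' Finset.univ_nonempty
        fun i => (x i + m u i) / ρ u i) ∂((stdGaussian (EuclideanSpace ℝ ι)).map
          fun x => 0 + Matrix.toEuclideanCLM (𝕜 := ℝ) (CFC.sqrt (S u)) x) =
      ∫ x, tiltedTail u (Finset.univ.sup' Finset.univ_nonempty
        fun i => ((∑ j, CFC.sqrt (S u) i j * x j) + m u i) / ρ u i)
          ∂(stdGaussian (EuclideanSpace ℝ ι)) := by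
    intro u
    rw [integral_map (by fun_prop)]
    · simp_rw [happ]
    · exact ((measurable_tiltedTail u).comp (Finset.measurable_univ_sup' fun i => by fun_prop)).aestronglyMeasurable
  have h2 : ∫ x, Real.exp (Finset.univ.sup' Finset.univ_nonempty
        fun i => x i + m₀ i) ∂((stdGaussian (EuclideanSpace ℝ ι)).map
          fun x => 0 + Matrix.toEuclideanCLM (𝕜 := ℝ) (CFC.sqrt S₀) x) =
      ∫ x, Real.exp (Finset.univ.sup' Finset.univ_nonempty
        fun i => (∑ j, CFC.sqrt S₀ i j * x j) + m₀ i) ∂(stdGaussian (EuclideanSpace ℝ ι)) := by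
    rw [integral_map (by fun_prop)]
    · simp_rw [happ]
    · exact (Real.measurable_exp.comp (Finset.measurable_univ_sup' fun i => by fun_prop)).aestronglyMeasurable
  simp_rw [h1, h2]
  set K : ℝ := ∑ i, ∑ j, (|CFC.sqrt S₀ i j| + 1) with hK
  set C : ℝ := ∑ i, (|m₀ i| + 1) with hC
  refine tendsto_integral_filter_of_dominated_convergence
    (fun x => Real.exp (2 * C) * Real.exp ((2 * K) * ‖x‖)) (.of_forall fun u => ?_) ?_
    ((IsGaussian.integrable_exp_mul_norm _ _).const_mul _) (.of_forall fun x => ?_)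
  · exact ((measurable_tiltedTail u).comp (Finset.measurable_univ_sup' fun i => by fun_prop)).aestronglyMeasurable
  · have e1 : ∀ᶠ u in atTop, ∀ i j, |CFC.sqrt (S u) i j| ≤ |CFC.sqrt S₀ i j| + 1 :=
      eventually_all.2 fun i => eventually_all.2 fun j =>
        ((hsq i j).abs.eventually_le_const (lt_add_one _))
    have e2 : ∀ᶠ u in atTop, ∀ i, |m u i| ≤ |m₀ i| + 1 :=
      eventually_all.2 fun i => (hm i).abs.eventually_le_const (lt_add_one _)
    have e3 : ∀ᶠ u in atTop, ∀ i, 1 / 2 ≤ ρ u i :=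
      eventually_all.2 fun i => (hρ i).eventually_const_le (by norm_num)
    filter_upwards [e1, e2, e3] with u h1 h2 h3
    refine .of_forall fun x => ?_
    rw [Real.norm_of_nonneg (tiltedTail_nonneg _ _)]
    refine (tiltedTail_le_exp _ _).trans ?_
    rw [← Real.exp_add, Real.exp_le_exp, Finset.sup'_le_iff]
    intro i _
    have hρi : 0 < ρ u i := by linarith [h3 i]
    have hA : ∑ j, CFC.sqrt (S u) i j * x j ≤ K * ‖x‖ := by
      calc ∑ j, CFC.sqrt (S u) i j * x j
          ≤ ∑ j, (|CFC.sqrt S₀ i j| + 1) * ‖x‖ := by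
            refine Finset.sum_le_sum fun j _ => (le_abs_self _).trans ?_
            rw [abs_mul]
            gcongr
            · exact h1 i j
            · exact PiLp.norm_apply_le x j
        _ = (∑ j, (|CFC.sqrt S₀ i j| + 1)) * ‖x‖ := by rw [Finset.sum_mul]
        _ ≤ K * ‖x‖ := by
            gcongr
            exact Finset.single_le_sum (f := fun i => ∑ j, (|CFC.sqrt S₀ i j| + 1))
              (fun i _ => Finset.sum_nonneg fun j _ => by positivity) (Finset.mem_univ i)
    have hB : m u i ≤ C := (le_abs_self _).trans ((h2 i).trans
      (Finset.single_le_sum (f := fun i => |m₀ i| + 1) (fun i _ => by positivity)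
        (Finset.mem_univ i)))
    have hK0 : 0 ≤ K := Finset.sum_nonneg fun i _ => Finset.sum_nonneg fun j _ => by positivity
    have hC0 : 0 ≤ C := Finset.sum_nonneg fun i _ => by positivity
    rw [div_le_iff₀ hρi]
    have : 0 ≤ K * ‖x‖ := by positivity
    nlinarith [h3 i]
  · refine tendsto_tiltedTail ?_
    refine Tendsto.finset_sup'_nhds_apply
      (f := fun i u => ((∑ j, CFC.sqrt (S u) i j * x j) + m u i) / ρ u i)
      (g := fun i => (∑ j, CFC.sqrt S₀ i j * x j) + m₀ i) Finset.univ_nonempty fun i _ => ?_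
    have h := ((tendsto_finsetSum Finset.univ fun j _ => (hsq i j).mul_const (x j)).add
      (hm i)).div (hρ i) one_ne_zero
    rw [div_one] at h
    exact h

end SqrtContinuity

section LocalScaling

variable {E : Type*} [NormedAddCommGroup E] [NormedSpace ℝ E] {α : ℝ} {r : E → ℝ}

lemma tendsto_rpow_neg_two_div_atTop (hα : 0 < α) :
    Tendsto (fun u : ℝ => u ^ (-2 / α)) atTop (𝓝 0) := by
  simpa [neg_div] using tendsto_rpow_neg_atTop (y := 2 / α) (by positivity)

lemma norm_rpow_neg_two_div_smul_rpow (hα : 0 < α) {u : ℝ} (hu : 0 < u) (t : E) :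
    ‖u ^ (-2 / α) • t‖ ^ α = (u ^ 2)⁻¹ * ‖t‖ ^ α := by
  have h0 : 0 ≤ u ^ (-2 / α) := Real.rpow_nonneg hu.le _
  rw [norm_smul, Real.norm_of_nonneg h0, Real.mul_rpow h0 (norm_nonneg _), ← Real.rpow_mul hu.le,
    div_mul_cancel₀ _ hα.ne', Real.rpow_neg hu.le, Real.rpow_two]

/-- A uniform version, on bounded sets, of the local behaviour of the covariance. -/
lemma eventually_abs_sq_mul_sub_le (hα : 0 < α)
    (hr : (fun t => r t - (1 - ‖t‖ ^ α)) =o[𝓝 0] fun t : E => ‖t‖ ^ α) (R : ℝ) {c : ℝ}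
    (hc : 0 < c) :
    ∀ᶠ u : ℝ in atTop, ∀ x : E, ‖x‖ ≤ R →
      |u ^ 2 * (1 - r (u ^ (-2 / α) • x)) - ‖x‖ ^ α| ≤ c * ‖x‖ ^ α := by
  obtain ⟨ε, hε, hball⟩ := Metric.eventually_nhds_iff.1 (hr.def hc)
  have h1 : ∀ᶠ u : ℝ in atTop, u ^ (-2 / α) * (|R| + 1) < ε := by
    have := (tendsto_rpow_neg_two_div_atTop hα).mul_const (|R| + 1)
    rw [zero_mul] at this
    exact this.eventually_lt_const hε
  filter_upwards [h1, eventually_gt_atTop 0] with u h1 hu x hx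
  have h0 : 0 ≤ u ^ (-2 / α) := Real.rpow_nonneg hu.le _
  have hb := hball (y := u ^ (-2 / α) • x) (by
    rw [dist_zero_right, norm_smul, Real.norm_of_nonneg h0]
    refine lt_of_le_of_lt (mul_le_mul_of_nonneg_left ?_ h0) h1
    linarith [le_abs_self R])
  rw [norm_rpow_neg_two_div_smul_rpow hα hu, Real.norm_eq_abs, Real.norm_of_nonneg
    (by positivity)] at hb
  have hu2 : 0 < u ^ 2 := by positivity
  have : u ^ 2 * (1 - r (u ^ (-2 / α) • x)) - ‖x‖ ^ α =
      -(u ^ 2 * (r (u ^ (-2 / α) • x) - (1 - (u ^ 2)⁻¹ * ‖x‖ ^ α))) := by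
    field_simp; ring
  rw [this, abs_neg, abs_mul, abs_of_pos hu2]
  calc _ ≤ u ^ 2 * (c * ((u ^ 2)⁻¹ * ‖x‖ ^ α)) := by gcongr
    _ = _ := by field_simp

lemma tendsto_sq_mul_one_sub (hα : 0 < α)
    (hr : (fun t => r t - (1 - ‖t‖ ^ α)) =o[𝓝 0] fun t : E => ‖t‖ ^ α) (x : E) :
    Tendsto (fun u : ℝ => u ^ 2 * (1 - r (u ^ (-2 / α) • x))) atTop (𝓝 (‖x‖ ^ α)) := by
  rw [Metric.tendsto_nhds]
  intro ε hε
  have hx : 0 ≤ ‖x‖ ^ α := by positivity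
  filter_upwards [eventually_abs_sq_mul_sub_le hα hr ‖x‖ (c := ε / (‖x‖ ^ α + 1))
    (by positivity)] with u hu
  rw [Real.dist_eq]
  refine (hu x le_rfl).trans_lt ?_
  rw [div_mul_eq_mul_div, div_lt_iff₀ (by positivity)]
  nlinarith

lemma tendsto_apply_smul_one (hα : 0 < α)
    (hr : (fun t => r t - (1 - ‖t‖ ^ α)) =o[𝓝 0] fun t : E => ‖t‖ ^ α) (x : E) :
    Tendsto (fun u : ℝ => r (u ^ (-2 / α) • x)) atTop (𝓝 1) := by
  have h2 : Tendsto (fun u : ℝ => (u ^ 2)⁻¹) atTop (𝓝 0) :=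
    (tendsto_pow_atTop two_ne_zero).inv_tendsto_atTop
  have h := ((tendsto_sq_mul_one_sub hα hr x).mul h2).const_sub 1
  rw [mul_zero, sub_zero] at h
  refine h.congr' ?_
  filter_upwards [eventually_gt_atTop 0] with u hu
  field_simp; ring

/-- Bounds on the covariance, uniform on bounded sets. -/
lemma eventually_nonneg_and_sq_mul_le (hα : 0 < α)
    (hr : (fun t => r t - (1 - ‖t‖ ^ α)) =o[𝓝 0] fun t : E => ‖t‖ ^ α) (R : ℝ) :
    ∀ᶠ u : ℝ in atTop, ∀ x : E, ‖x‖ ≤ R →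
      0 ≤ r (u ^ (-2 / α) • x) ∧ u ^ 2 * (1 - r (u ^ (-2 / α) • x)) ≤ 2 * ‖x‖ ^ α := by
  filter_upwards [eventually_abs_sq_mul_sub_le hα hr R one_pos, eventually_gt_atTop 0,
    (tendsto_pow_atTop (α := ℝ) two_ne_zero).eventually_ge_atTop (2 * (|R| + 1) ^ α)]
    with u h hu hu2 x hx
  have h1 := (abs_le.1 (h x hx)).2
  have h2 : ‖x‖ ^ α ≤ (|R| + 1) ^ α := by
    gcongr
    linarith [le_abs_self R]
  refine ⟨?_, by linarith⟩
  by_contra! hneg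
  have hu' : 0 < u ^ 2 := by positivity
  nlinarith

end LocalScaling

lemma ProbabilityTheory.IsGaussianProcess.hasGaussianLaw_pi {Ω ι : Type*} [MeasurableSpace Ω]
    {P : Measure Ω} [Fintype ι] {Y : ι → Ω → ℝ} (hY : IsGaussianProcess Y P) :
    HasGaussianLaw (fun ω i => Y i ω) P :=
  (hY.hasGaussianLaw Finset.univ).map (ContinuousLinearMap.pi fun i =>
    ContinuousLinearMap.proj (R := ℝ) (φ := fun _ : (Finset.univ : Finset ι) => ℝ)
      ⟨i, Finset.mem_univ i⟩)

open scoped MatrixOrder in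
lemma multivariateGaussian_eq_map_add {ι : Type*} [Fintype ι] [DecidableEq ι]
    (m : EuclideanSpace ℝ ι) (S : Matrix ι ι ℝ) :
    multivariateGaussian m S = (multivariateGaussian 0 S).map fun x => m + x := by
  rw [multivariateGaussian, multivariateGaussian, Measure.map_map (by fun_prop) (by fun_prop)]
  congr 1
  ext x
  simp

namespace IsChiAlpha

variable {Ω : Type*} [MeasurableSpace Ω] {P : Measure Ω} {n : ℕ} {α : ℝ}
  {χ : EuclideanSpace ℝ (Fin n) → Ω → ℝ}

lemma isGaussianProcess (hχ : IsChiAlpha P α χ) : IsGaussianProcess χ P :=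
  hχ.gaussian.isGaussianProcess hχ.meas

lemma integrable_exp (hχ : IsChiAlpha P α χ) (t : EuclideanSpace ℝ (Fin n)) :
    Integrable (fun ω => Real.exp (χ t ω)) P := by
  have h := integrable_exp_mul_gaussianReal (μ := ∫ ω, χ t ω ∂P) (v := Var[χ t; P].toNNReal) 1
  rw [← (hχ.isGaussianProcess.hasGaussianLaw_eval t).map_eq_gaussianReal,
    integrable_map_measure (by fun_prop) (hχ.meas t).aemeasurable] at h
  simpa [Function.comp_def] using h

lemma integrable_exp_sup (hχ : IsChiAlpha P α χ) {ι : Type*} [Fintype ι] [Nonempty ι]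
    (x : ι → EuclideanSpace ℝ (Fin n)) :
    Integrable (fun ω => Real.exp (Finset.univ.sup' Finset.univ_nonempty fun i => χ (x i) ω)) P := by
  refine (integrable_finsetSum Finset.univ fun i _ => hχ.integrable_exp (x i)).mono'
    (Finset.measurable_univ_sup' fun i => hχ.meas _).exp.aestronglyMeasurable
    (.of_forall fun ω => ?_)
  rw [Real.norm_of_nonneg (Real.exp_pos _).le]
  obtain ⟨i, -, hi⟩ := Finset.exists_mem_eq_sup' Finset.univ_nonempty fun i => χ (x i) ω
  rw [hi]
  exact Finset.single_le_sum (f := fun i => Real.exp (χ (x i) ω))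
    (fun i _ => (Real.exp_pos _).le) (Finset.mem_univ i)

variable [IsProbabilityMeasure P]

lemma covariance_eq (hχ : IsChiAlpha P α χ) (s t : EuclideanSpace ℝ (Fin n)) :
    cov[χ s, χ t; P] = ‖s‖ ^ α + ‖t‖ ^ α - ‖s - t‖ ^ α := by
  rw [covariance_eq_sub (hχ.isGaussianProcess.hasGaussianLaw_eval s).memLp_two
    (hχ.isGaussianProcess.hasGaussianLaw_eval t).memLp_two, ← hχ.cov]
  rfl

/-- The joint law of finitely many values of `χ`. -/
lemma posSemidef_and_map_eq (hχ : IsChiAlpha P α χ) {ι : Type*} [Fintype ι] [DecidableEq ι]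
    (x : ι → EuclideanSpace ℝ (Fin n)) :
    (Matrix.of fun i j => ‖x i‖ ^ α + ‖x j‖ ^ α - ‖x i - x j‖ ^ α).PosSemidef ∧
    P.map (fun ω => WithLp.toLp 2 fun i => χ (x i) ω) =
      (multivariateGaussian 0 (Matrix.of fun i j => ‖x i‖ ^ α + ‖x j‖ ^ α - ‖x i - x j‖ ^ α)).map
        fun y => WithLp.toLp 2 (fun i => -‖x i‖ ^ α) + y := by
  have hG : HasGaussianLaw (fun ω i => χ (x i) ω) P := by
    have := hχ.isGaussianProcess.linear_comb_two x x (fun _ => 1) (fun _ => 0)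
    simp only [one_mul, zero_mul, add_zero] at this
    exact this.hasGaussianLaw_pi
  rw [← multivariateGaussian_eq_map_add]
  exact hG.map_toLp_eq_multivariateGaussian (fun i => hχ.mean _) fun i j => hχ.covariance_eq _ _

lemma integral_exp_sup_eq (hχ : IsChiAlpha P α χ) {ι : Type*} [Fintype ι] [Nonempty ι]
    [DecidableEq ι] (x : ι → EuclideanSpace ℝ (Fin n)) (δ : ℝ) :
    ∫ ω, Real.exp (Finset.univ.sup' Finset.univ_nonempty fun i => χ (x i) ω + δ) ∂P =
      ∫ y, Real.exp (Finset.univ.sup' Finset.univ_nonempty fun i => y i + (-‖x i‖ ^ α + δ))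
        ∂(multivariateGaussian 0
          (Matrix.of fun i j => ‖x i‖ ^ α + ‖x j‖ ^ α - ‖x i - x j‖ ^ α)) := by
  have hm : Measurable fun y : EuclideanSpace ℝ ι =>
      Real.exp (Finset.univ.sup' Finset.univ_nonempty fun i => y i + δ) :=
    (Finset.measurable_univ_sup' fun i => by fun_prop).exp
  have hχm : Measurable fun ω => WithLp.toLp 2 fun i => χ (x i) ω :=
    (WithLp.measurable_toLp 2 _).comp (measurable_pi_lambda _ fun i => hχ.meas _)
  have h := integral_map (μ := P) hχm.aemeasurable hm.aestronglyMeasurable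
  rw [(hχ.posSemidef_and_map_eq x).2,
    integral_map (by fun_prop) hm.aestronglyMeasurable] at h
  rw [← h]
  refine integral_congr_ae (.of_forall fun y => congrArg Real.exp
    (Finset.sup'_congr _ rfl fun i _ => ?_))
  simp only [PiLp.add_apply]
  ring

end IsChiAlpha

/-- Exceedance probabilities over finitely many rescaled points. -/
lemma IsHomogGaussianField.tendsto_measureReal_exists_div_PsiFn {Ω Ω' ι : Type*}
    [MeasurableSpace Ω] {P : Measure Ω} [IsProbabilityMeasure P] {n : ℕ} {α : ℝ} (hα : 0 < α)
    {X : EuclideanSpace ℝ (Fin n) → Ω → ℝ} {r : EuclideanSpace ℝ (Fin n) → ℝ}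
    (hX : IsHomogGaussianField P X r)
    (hr : (fun t => r t - (1 - ‖t‖ ^ α))
      =o[𝓝 0] fun t : EuclideanSpace ℝ (Fin n) => ‖t‖ ^ α)
    [MeasurableSpace Ω'] {P' : Measure Ω'} [IsProbabilityMeasure P']
    {χ : EuclideanSpace ℝ (Fin n) → Ω' → ℝ} (hχ : IsChiAlpha P' α χ)
    [Fintype ι] [Nonempty ι] (x : ι → EuclideanSpace ℝ (Fin n)) (δ : ℝ) :
    Tendsto (fun u : ℝ => P.real {ω | ∃ i, u - δ / u < X (u ^ (-2 / α) • x i) ω} / PsiFn u) atTop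
      (𝓝 (∫ ω, Real.exp (Finset.univ.sup' Finset.univ_nonempty fun i => χ (x i) ω + δ) ∂P')) := by
  classical
  set V : ℝ → ι → Ω → ℝ := fun u i ω =>
    u * X (u ^ (-2 / α) • x i) ω + -(u * r (u ^ (-2 / α) • x i)) * X 0 ω with hV
  set S : ℝ → Matrix ι ι ℝ := fun u => Matrix.of fun i j =>
    u ^ 2 * (r (u ^ (-2 / α) • (x i - x j)) -
      r (u ^ (-2 / α) • x i) * r (u ^ (-2 / α) • x j)) with hS
  have hlaw : ∀ u, (S u).PosSemidef ∧ P.map (fun ω => WithLp.toLp 2 fun i => V u i ω) =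
      multivariateGaussian 0 (S u) := by
    intro u
    have hG : HasGaussianLaw (fun ω i => V u i ω) P :=
      (hX.isGaussianProcess.linear_comb_two (fun i => u ^ (-2 / α) • x i) (fun _ => 0)
        (fun _ => u) (fun i => -(u * r (u ^ (-2 / α) • x i)))).hasGaussianLaw_pi
    refine hG.map_toLp_eq_multivariateGaussian (m := 0) (fun i => ?_) fun i j => ?_
    · rw [hV]
      simp only
      rw [integral_add (((hX.memLp_two _).integrable one_le_two).const_mul _)
        (((hX.memLp_two _).integrable one_le_two).const_mul _), integral_const_mul,
        integral_const_mul, hX.mean, hX.mean]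
      simp
    · have hVe : ∀ i, V u i = fun ω => u * (1 * X (u ^ (-2 / α) • x i) ω +
          -r (u ^ (-2 / α) • x i) * X 0 ω) := by
        intro i; ext ω; simp only [hV]; ring
      rw [hVe, hVe, covariance_const_mul_left, covariance_const_mul_right,
        hX.covariance_residual, sub_zero, sub_zero, ← smul_sub]
      simp only [hS, Matrix.of_apply]
      ring
  have hSlim : ∀ i j, Tendsto (fun u => S u i j) atTop
      (𝓝 (Matrix.of (fun i j => ‖x i‖ ^ α + ‖x j‖ ^ α - ‖x i - x j‖ ^ α) i j)) := by
    intro i j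
    have h := ((tendsto_sq_mul_one_sub hα hr (x i)).add
      ((tendsto_apply_smul_one hα hr (x i)).mul (tendsto_sq_mul_one_sub hα hr (x j)))).sub
      (tendsto_sq_mul_one_sub hα hr (x i - x j))
    rw [one_mul] at h
    refine h.congr fun u => ?_
    simp only [hS, Matrix.of_apply]
    ring
  have hmain := tendsto_integral_tiltedTail_sup (.of_forall fun u => (hlaw u).1)
    (hχ.posSemidef_and_map_eq x).1 hSlim
    (m := fun u i => -(u ^ 2 * (1 - r (u ^ (-2 / α) • x i))) + δ)
    (fun i => (tendsto_sq_mul_one_sub hα hr (x i)).neg.add_const δ)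
    (fun i => tendsto_apply_smul_one hα hr (x i))
  rw [hχ.integral_exp_sup_eq]
  refine hmain.congr' ?_
  have hpos : ∀ᶠ u : ℝ in atTop, ∀ i, 0 < r (u ^ (-2 / α) • x i) :=
    eventually_all.2 fun i => (tendsto_apply_smul_one hα hr (x i)).eventually_const_lt one_pos
  filter_upwards [eventually_gt_atTop 0, hpos] with u hu hρ
  have hYm : ∀ i, Measurable fun ω => 1 * X (u ^ (-2 / α) • x i) ω +
      -r (u ^ (-2 / α) • x i - 0) * X 0 ω :=
    fun i => ((hX.meas _).const_mul _).add ((hX.meas _).const_mul _)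
  have h := measureReal_exists_lt_mul_add_eq (hX.meas 0) hYm (hX.map_eq 0)
    (hX.indepFun_residual 0 fun i => u ^ (-2 / α) • x i) hρ hu δ
  rw [eq_div_iff (PsiFn_pos hu).ne', mul_comm]
  have hset : {ω | ∃ i, u - δ / u < X (u ^ (-2 / α) • x i) ω} =
      {ω | ∃ i, u - δ / u < r (u ^ (-2 / α) • x i) * X 0 ω +
        (1 * X (u ^ (-2 / α) • x i) ω + -r (u ^ (-2 / α) • x i - 0) * X 0 ω)} := by
    ext ω
    refine exists_congr fun i => ?_
    rw [sub_zero]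
    ring_nf
  rw [hset, h, ← (hlaw u).2, integral_map]
  · refine congrArg (PsiFn u * ·) (integral_congr_ae (.of_forall fun ω => congrArg (tiltedTail u)
      (Finset.sup'_congr _ rfl fun i _ => ?_)))
    simp only [hV, sub_zero]
    ring
  · refine ((WithLp.measurable_toLp 2 _).comp (measurable_pi_lambda _ fun i => ?_)).aemeasurable
    exact ((hX.meas _).const_mul _).add ((hX.meas _).const_mul _)
  · exact ((measurable_tiltedTail u).comp
      (Finset.measurable_univ_sup' fun i => by fun_prop)).aestronglyMeasurable

/-- Finite nets of a bounded set at dyadic scales, with geometrically growing cardinality. -/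
lemma Bornology.IsBounded.exists_dyadic_nets {n : ℕ} {T : Set (EuclideanSpace ℝ (Fin n))}
    (hT : Bornology.IsBounded T) (hTne : T.Nonempty) :
    ∃ (N : ℕ → Finset (EuclideanSpace ℝ (Fin n))) (D K : ℝ), 0 < D ∧ 1 ≤ K ∧
      (∀ k, ∀ s ∈ N k, s ∈ T) ∧ (∀ k, ((N k).card : ℝ) ≤ D * K ^ k) ∧
      ∀ k, ∀ t ∈ T, ∃ s ∈ N k, ‖t - s‖ ≤ √n * (1 / 2) ^ k := by
  classical
  obtain ⟨R, hR⟩ := hT.exists_norm_le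
  obtain ⟨t₀, ht₀⟩ := hTne
  obtain ⟨B, hB⟩ := exists_nat_ge (R + 1)
  have hB1 : (1 : ℝ) ≤ B := by linarith [(norm_nonneg t₀).trans (hR t₀ ht₀)]
  let key : ℕ → EuclideanSpace ℝ (Fin n) → Fin n → ℤ := fun k t i => ⌊(2 : ℝ) ^ k * t i⌋
  let f : ℕ → (Fin n → ℤ) → EuclideanSpace ℝ (Fin n) := fun k z =>
    if h : ∃ t ∈ T, key k t = z then h.choose else t₀
  let W : ℕ → Finset (Fin n → ℤ) := fun k =>
    Fintype.piFinset fun _ => Finset.Icc (-(2 ^ k * B : ℤ)) (2 ^ k * B)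
  refine ⟨fun k => (W k).image (f k), (3 * B) ^ n, 2 ^ n, by positivity,
    one_le_pow₀ one_le_two, fun k s hs => ?_, fun k => ?_, fun k t ht => ?_⟩
  · obtain ⟨z, -, rfl⟩ := Finset.mem_image.1 hs
    simp only [f]
    split_ifs with h
    · exact h.choose_spec.1
    · exact ht₀
  · have h1 : ((W k).card : ℝ) = (2 * (2 ^ k * B) + 1) ^ n := by
      simp only [W, Fintype.card_piFinset, Int.card_Icc, Finset.prod_const, Finset.card_univ,
        Fintype.card_fin, Nat.cast_pow]
      congr 1
      have : (2 ^ k * B + 1 - -(2 ^ k * B) : ℤ) = ((2 * (2 ^ k * B) + 1 : ℕ) : ℤ) := by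
        push_cast; ring
      rw [this, Int.toNat_natCast]
      push_cast; ring
    calc (((W k).image (f k)).card : ℝ) ≤ (W k).card := by exact_mod_cast Finset.card_image_le
      _ = (2 * (2 ^ k * B) + 1) ^ n := h1
      _ ≤ (3 * B * 2 ^ k) ^ n := by
        gcongr
        have : (1 : ℝ) ≤ 2 ^ k := one_le_pow₀ one_le_two
        nlinarith
      _ = (3 * B) ^ n * (2 ^ n) ^ k := by rw [mul_pow, ← pow_mul, ← pow_mul, mul_comm n k]
  · have h2k : (0 : ℝ) < 2 ^ k := by positivity
    have hmem : key k t ∈ W k := by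
      simp only [W, key, Fintype.mem_piFinset, Finset.mem_Icc]
      intro i
      have hti := abs_le.1 ((PiLp.norm_apply_le t i).trans (hR t ht))
      constructor
      · rw [Int.le_floor]
        push_cast
        nlinarith
      · have : ((⌊(2 : ℝ) ^ k * t i⌋ : ℤ) : ℝ) ≤ ((2 ^ k * B : ℤ) : ℝ) := by
          refine (Int.floor_le _).trans ?_
          push_cast
          nlinarith
        exact_mod_cast this
    refine ⟨f k (key k t), Finset.mem_image_of_mem _ hmem, ?_⟩
    have hex : ∃ t' ∈ T, key k t' = key k t := ⟨t, ht, rfl⟩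
    have hkey : key k (f k (key k t)) = key k t := by
      simp only [f, dif_pos hex]
      exact hex.choose_spec.2
    rw [EuclideanSpace.norm_eq, ← Real.sqrt_sq (by positivity : (0 : ℝ) ≤ √n * (1 / 2) ^ k)]
    refine Real.sqrt_le_sqrt ?_
    calc ∑ i, ‖(t - f k (key k t)) i‖ ^ 2 ≤ ∑ _i : Fin n, ((1 / 2 : ℝ) ^ k) ^ 2 := by
          refine Finset.sum_le_sum fun i _ => ?_
          have h1 := Int.abs_sub_lt_one_of_floor_eq_floor (congrFun hkey i)
          rw [← mul_sub, abs_mul, abs_of_pos h2k] at h1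
          have h2 : |(f k (key k t)) i - t i| ≤ (1 / 2) ^ k := by
            rw [one_div, inv_pow, ← one_div, le_div_iff₀ h2k]
            linarith
          rw [PiLp.sub_apply, Real.norm_eq_abs, abs_sub_comm]
          gcongr
      _ = (√n * (1 / 2) ^ k) ^ 2 := by
          rw [mul_pow, Real.sq_sqrt (Nat.cast_nonneg n)]
          simp

/-- If a continuous function exceeds `b` on `T`, then along a chain of nets it either exceeds the
first level, or crosses two successive levels between neighbouring points. -/
lemma exists_level_crossing {E : Type*} [NormedAddCommGroup E] {T : Set E} {N : ℕ → Finset E}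
    {L : ℝ} (hN : ∀ k, ∀ t ∈ T, ∃ s ∈ N k, ‖t - s‖ ≤ L * (1 / 2) ^ k) {f : E → ℝ}
    (hf : Continuous f) {a : ℕ → ℝ} {b : ℝ} (ha : ∀ k, a k ≤ b) {t : E} (ht : t ∈ T)
    (hb : b < f t) (m : ℕ) :
    (∃ s ∈ N m, a m < f s) ∨ ∃ j, ∃ s ∈ N (j + m), ∃ s' ∈ N (j + m + 1),
      ‖s - s'‖ ≤ 2 * L * (1 / 2) ^ (j + m) ∧ f s ≤ a (j + m) ∧ a (j + m + 1) < f s' := by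
  classical
  choose s hs hst using fun k => hN k t ht
  have hlim : Tendsto s atTop (𝓝 t) := by
    rw [tendsto_iff_norm_sub_tendsto_zero]
    refine squeeze_zero (fun _ => norm_nonneg _) (fun k => (norm_sub_rev _ _).trans_le (hst k)) ?_
    simpa using (tendsto_pow_atTop_nhds_zero_of_lt_one (r := (1 / 2 : ℝ)) (by norm_num)
      (by norm_num)).const_mul L
  have hev : ∀ᶠ k in atTop, b < f (s k) := ((hf.tendsto t).comp hlim).eventually_const_lt hb
  obtain ⟨k₀, hk₀⟩ := eventually_atTop.1 hev
  have hex : ∃ j, a (j + m) < f (s (j + m)) :=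
    ⟨k₀, (ha _).trans_lt (hk₀ _ (Nat.le_add_right _ _))⟩
  rcases h : Nat.find hex with _ | j
  · left
    have := Nat.find_spec hex
    rw [h, zero_add] at this
    exact ⟨s m, hs m, this⟩
  · right
    have h1 := Nat.find_spec hex
    have h2 := Nat.find_min hex (m := j) (by omega)
    rw [h, Nat.add_right_comm] at h1
    refine ⟨j, s (j + m), hs _, s (j + m + 1), hs _, ?_, not_lt.1 h2, h1⟩
    have h3 : L * (1 / 2) ^ (j + m + 1) ≤ L * (1 / 2) ^ (j + m) := by
      have := (norm_nonneg _).trans (hst (j + m + 1))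
      rw [pow_succ] at this ⊢
      nlinarith
    calc ‖s (j + m) - s (j + m + 1)‖
        = ‖(t - s (j + m + 1)) - (t - s (j + m))‖ := by congr 1; abel
      _ ≤ ‖t - s (j + m + 1)‖ + ‖t - s (j + m)‖ := norm_sub_le _ _
      _ ≤ 2 * L * (1 / 2) ^ (j + m) := by linarith [hst (j + m), hst (j + m + 1)]

lemma summable_pow_mul_exp_neg_pow {B c β : ℝ} (hB : 1 ≤ B) (hc : 0 < c) (hβ : 1 < β) :
    Summable fun k : ℕ => B ^ k * Real.exp (-(c * β ^ k)) := by
  have hlog : 0 < Real.log (2 * B) := Real.log_pos (by linarith)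
  have h := (tendsto_pow_const_div_const_pow_of_one_lt 1 hβ).eventually_le_const
    (div_pos hc hlog)
  refine Summable.of_norm_bounded_eventually_nat summable_geometric_two ?_
  filter_upwards [h] with k hk
  have hβk : 0 < β ^ k := by positivity
  rw [Real.norm_of_nonneg (by positivity), pow_one, div_le_div_iff₀ hβk hlog] at *
  have h2 : (2 * B) ^ k ≤ Real.exp (c * β ^ k) := by
    rw [← Real.exp_log (by positivity : 0 < 2 * B), ← Real.exp_nat_mul]
    exact Real.exp_le_exp.2 hk
  rw [Real.exp_neg, ← div_eq_mul_inv, div_le_iff₀ (Real.exp_pos _)]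
  calc B ^ k = (1 / 2) ^ k * (2 * B) ^ k := by rw [← mul_pow]; congr 1; ring
    _ ≤ _ := by gcongr

/-- The choice of levels in the chaining argument. -/
lemma exists_chaining_levels {C ρ : ℝ} (hC : 0 < C) (hρ0 : 0 < ρ) (hρ1 : ρ < 1) {B : ℝ}
    (hB : 1 ≤ B) :
    ∃ δ : ℕ → ℝ, (∀ k, 0 ≤ δ k) ∧ (∀ k, δ k ≤ 1) ∧ Tendsto δ atTop (𝓝 0) ∧
      (∀ᶠ k in atTop, C * ρ ^ k ≤ (δ k - δ (k + 1)) / 2) ∧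
      Summable fun k => B ^ k * Real.exp (-(δ k - δ (k + 1)) ^ 2 / (16 * (C * ρ ^ k))) := by
  set θ : ℝ := √(√ρ) with hθ
  have hθ0 : 0 < θ := by positivity
  have hθ4 : θ ^ 4 = ρ := by
    rw [show θ ^ 4 = (θ ^ 2) ^ 2 by ring, hθ, Real.sq_sqrt (by positivity),
      Real.sq_sqrt hρ0.le]
  have hθ1 : θ < 1 := by
    by_contra! h
    linarith [one_le_pow₀ (n := 4) h]
  refine ⟨fun k => θ ^ k, fun k => by positivity, fun k => pow_le_one₀ hθ0.le hθ1.le,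
    tendsto_pow_atTop_nhds_zero_of_lt_one hθ0.le hθ1, ?_, ?_⟩
  · have h3 : θ ^ 3 < 1 := pow_lt_one₀ hθ0.le hθ1 (by norm_num)
    have h := ((tendsto_pow_atTop_nhds_zero_of_lt_one (by positivity) h3).const_mul
      C).eventually_le_const (u := (1 - θ) / 2) (by linarith)
    filter_upwards [h] with k hk
    have hk' : 0 < θ ^ k := by positivity
    calc C * ρ ^ k = (C * (θ ^ 3) ^ k) * θ ^ k := by rw [← hθ4]; ring
      _ ≤ (1 - θ) / 2 * θ ^ k := by gcongr
      _ = _ := by ring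
  · have h2 : 1 < (θ ^ 2)⁻¹ := (one_lt_inv₀ (by positivity)).2 (pow_lt_one₀ hθ0.le hθ1 two_ne_zero)
    have h1 : 0 < 1 - θ := by linarith
    convert! summable_pow_mul_exp_neg_pow hB (c := (1 - θ) ^ 2 / (16 * C)) (by positivity) h2
      using 4 with k
    have e1 : ρ ^ k = (θ ^ k) ^ 4 := by rw [← hθ4]; ring
    have e2 : (θ ^ 2)⁻¹ ^ k = ((θ ^ k) ^ 2)⁻¹ := by rw [inv_pow]; ring
    rw [e1, e2, pow_succ]
    have hk : 0 < θ ^ k := by positivity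
    field_simp
    ring

/-- Chaining: the exceedance probability over `T` is bounded by the one over a finite net, up to
the tail of a convergent series. -/
lemma IsHomogGaussianField.eventually_measureReal_exists_div_PsiFn_le {Ω : Type*}
    [MeasurableSpace Ω] {P : Measure Ω} [IsProbabilityMeasure P] {n : ℕ} {α : ℝ} (hα : 0 < α)
    {X : EuclideanSpace ℝ (Fin n) → Ω → ℝ} {r : EuclideanSpace ℝ (Fin n) → ℝ}
    (hX : IsHomogGaussianField P X r)
    (hr : (fun t => r t - (1 - ‖t‖ ^ α))
      =o[𝓝 0] fun t : EuclideanSpace ℝ (Fin n) => ‖t‖ ^ α)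
    {T : Set (EuclideanSpace ℝ (Fin n))} {N : ℕ → Finset (EuclideanSpace ℝ (Fin n))} {L : ℝ}
    (hL : 0 ≤ L) (hN : ∀ k, ∀ t ∈ T, ∃ s ∈ N k, ‖t - s‖ ≤ L * (1 / 2) ^ k)
    {δ κ w : ℕ → ℝ} (hδ0 : ∀ k, 0 ≤ δ k) (hδ1 : ∀ k, δ k ≤ 1)
    (hκ : ∀ k, 2 * (2 * L * (1 / 2) ^ k) ^ α ≤ κ k) {m : ℕ}
    (hκδ : ∀ k, m ≤ k → κ k ≤ (δ k - δ (k + 1)) / 2) (hws : Summable w)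
    (hw : ∀ k, (N k).card * (N (k + 1)).card *
      (Real.exp 1 * Real.exp (-(δ k - δ (k + 1)) ^ 2 / (16 * κ k))) ≤ w k) :
    ∀ᶠ u : ℝ in atTop, P.real {ω | ∃ t ∈ T, u < X (u ^ (-2 / α) • t) ω} / PsiFn u ≤
      P.real {ω | ∃ s : N m, u - δ m / u < X (u ^ (-2 / α) • (s : EuclideanSpace ℝ (Fin n))) ω} /
        PsiFn u + ∑' j, w (j + m) := by
  filter_upwards [eventually_gt_atTop 0, eventually_nonneg_and_sq_mul_le hα hr (2 * L)]
    with u hu hru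
  have hΨ := PsiFn_pos hu
  set q := u ^ (-2 / α)
  have hw0 : ∀ k, 0 ≤ w k := fun k => le_trans (by positivity) (hw k)
  let B : ℕ → Set Ω := fun j => ⋃ s ∈ N (j + m), ⋃ s' ∈ N (j + m + 1),
    {ω | ‖s - s'‖ ≤ 2 * L * (1 / 2) ^ (j + m) ∧ X (q • s) ω ≤ u - δ (j + m) / u ∧
      u - δ (j + m + 1) / u < X (q • s') ω}
  have hB : ∀ j, P.real (B j) ≤ PsiFn u * w (j + m) := by
    intro j
    have hpair : ∀ s s' : EuclideanSpace ℝ (Fin n),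
        P.real {ω | ‖s - s'‖ ≤ 2 * L * (1 / 2) ^ (j + m) ∧ X (q • s) ω ≤ u - δ (j + m) / u ∧
          u - δ (j + m + 1) / u < X (q • s') ω} ≤ PsiFn u * (Real.exp 1 *
            Real.exp (-(δ (j + m) - δ (j + m + 1)) ^ 2 / (16 * κ (j + m)))) := by
      intro s s'
      by_cases hs : ‖s - s'‖ ≤ 2 * L * (1 / 2) ^ (j + m)
      · have hs2 : ‖s - s'‖ ≤ 2 * L :=
          hs.trans (mul_le_of_le_one_right (by positivity)
            (pow_le_one₀ (by norm_num) (by norm_num)))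
        obtain ⟨h1, h2⟩ := hru _ hs2
        rw [smul_sub] at h1 h2
        simp only [hs, true_and]
        refine (hX.measureReal_increment_le (q • s) (q • s') hu (hδ0 _) h1 (h2.trans ?_)
          (hκδ _ (Nat.le_add_left _ _))).trans ?_
        · refine le_trans ?_ (hκ _)
          gcongr
        · gcongr
          exact hδ1 _
      · simp only [hs, false_and]
        rw [show {ω : Ω | False} = ∅ from rfl, measureReal_empty]
        positivity
    calc P.real (B j) ≤ ∑ s ∈ N (j + m), ∑ s' ∈ N (j + m + 1), PsiFn u * (Real.exp 1 *
            Real.exp (-(δ (j + m) - δ (j + m + 1)) ^ 2 / (16 * κ (j + m)))) :=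
          (measureReal_biUnion_finset_le _ _).trans (Finset.sum_le_sum fun s _ =>
            (measureReal_biUnion_finset_le _ _).trans (Finset.sum_le_sum fun s' _ => hpair s s'))
      _ = PsiFn u * ((N (j + m)).card * (N (j + m + 1)).card * (Real.exp 1 *
            Real.exp (-(δ (j + m) - δ (j + m + 1)) ^ 2 / (16 * κ (j + m))))) := by
          simp only [Finset.sum_const, nsmul_eq_mul]
          ring
      _ ≤ PsiFn u * w (j + m) := by
          gcongr
          exact hw _
  have hsub : {ω | ∃ t ∈ T, u < X (q • t) ω} ⊆
      {ω | ∃ s : N m, u - δ m / u < X (q • (s : EuclideanSpace ℝ (Fin n))) ω} ∪ ⋃ j, B j := by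
    rintro ω ⟨t, ht, hut⟩
    rcases exists_level_crossing hN (f := fun x => X (q • x) ω)
      ((hX.cont ω).comp (continuous_const_smul q)) (a := fun k => u - δ k / u) (b := u)
      (fun k => by
        have := div_nonneg (hδ0 k) hu.le
        linarith) ht hut m with ⟨s, hs, h⟩ | ⟨j, s, hs, s', hs', h⟩
    · exact Or.inl ⟨⟨s, hs⟩, h⟩
    · refine Or.inr (Set.mem_iUnion.2 ⟨j, ?_⟩)
      simp only [B, Set.mem_iUnion]
      exact ⟨s, hs, s', hs', h⟩
  have hsum : Summable fun j => w (j + m) := (summable_nat_add_iff m).2 hws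
  have htail : P.real (⋃ j, B j) ≤ PsiFn u * ∑' j, w (j + m) := by
    rw [← tsum_mul_left]
    refine ENNReal.toReal_le_of_le_ofReal
      (tsum_nonneg fun j => mul_nonneg hΨ.le (hw0 _)) ?_
    rw [ENNReal.ofReal_tsum_of_nonneg (fun j => mul_nonneg hΨ.le (hw0 _)) (hsum.mul_left _)]
    refine (measure_iUnion_le _).trans (ENNReal.tsum_le_tsum fun j => ?_)
    rw [← ofReal_measureReal (measure_ne_top P (B j))]
    exact ENNReal.ofReal_le_ofReal (hB j)
  rw [div_le_iff₀ hΨ, add_mul, div_mul_cancel₀ _ hΨ.ne', mul_comm (∑' j, w (j + m))]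
  exact (measureReal_mono hsub).trans ((measureReal_union_le _ _).trans (by gcongr))

/-- Maxima over finer and finer nets converge to the supremum. -/
lemma tendsto_sup'_dyadic_nets {E : Type*} [NormedAddCommGroup E] {T : Set E} (hT : IsCompact T)
    (hTne : T.Nonempty) {N : ℕ → Finset E} (hNT : ∀ k, ∀ s ∈ N k, s ∈ T) {L : ℝ}
    (hN : ∀ k, ∀ t ∈ T, ∃ s ∈ N k, ‖t - s‖ ≤ L * (1 / 2) ^ k) [hne : ∀ k, Nonempty (N k)]
    {f : E → ℝ} (hf : Continuous f) :
    (∀ k, Finset.univ.sup' Finset.univ_nonempty (fun s : N k => f s) ≤ sSup (f '' T)) ∧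
    Tendsto (fun k => Finset.univ.sup' Finset.univ_nonempty fun s : N k => f s) atTop
      (𝓝 (sSup (f '' T))) := by
  have hbdd : BddAbove (f '' T) := (hT.image hf).bddAbove
  have hle : ∀ k, Finset.univ.sup' Finset.univ_nonempty (fun s : N k => f s) ≤ sSup (f '' T) :=
    fun k => Finset.sup'_le _ _ fun s _ => le_csSup hbdd ⟨s, hNT k s s.2, rfl⟩
  refine ⟨hle, ?_⟩
  obtain ⟨t, ht, hsup⟩ := hT.exists_sSup_image_eq hTne hf.continuousOn
  choose s hs hst using fun k => hN k t ht
  have hlim : Tendsto s atTop (𝓝 t) := by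
    rw [tendsto_iff_norm_sub_tendsto_zero]
    refine squeeze_zero (fun _ => norm_nonneg _) (fun k => (norm_sub_rev _ _).trans_le (hst k)) ?_
    simpa using (tendsto_pow_atTop_nhds_zero_of_lt_one (r := (1 / 2 : ℝ)) (by norm_num)
      (by norm_num)).const_mul L
  have hfs : Tendsto (fun k => f (s k)) atTop (𝓝 (sSup (f '' T))) := by
    rw [hsup]
    exact (hf.tendsto t).comp hlim
  exact tendsto_of_tendsto_of_tendsto_of_le_of_le hfs tendsto_const_nhds
    (fun k => Finset.le_sup' (fun s : N k => f s) (Finset.mem_univ (⟨s k, hs k⟩ : N k))) hle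

/-- Dominated convergence for the expected exponential of the maximum over a net, once these
expectations are bounded. -/
lemma IsChiAlpha.tendsto_integral_exp_sup {Ω : Type*} [MeasurableSpace Ω] {P : Measure Ω}
    {n : ℕ} {α : ℝ} {χ : EuclideanSpace ℝ (Fin n) → Ω → ℝ}
    (hχ : IsChiAlpha P α χ) {T : Set (EuclideanSpace ℝ (Fin n))} (hT : IsCompact T)
    (hTne : T.Nonempty) {N : ℕ → Finset (EuclideanSpace ℝ (Fin n))}
    (hNT : ∀ k, ∀ s ∈ N k, s ∈ T) {L : ℝ}
    (hN : ∀ k, ∀ t ∈ T, ∃ s ∈ N k, ‖t - s‖ ≤ L * (1 / 2) ^ k) [hne : ∀ k, Nonempty (N k)]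
    {C : ℝ} (hC : ∀ k, ∫ ω, Real.exp (Finset.univ.sup' Finset.univ_nonempty
      fun s : N k => χ s ω) ∂P ≤ C) :
    Integrable (fun ω => Real.exp (sSup ((fun t => χ t ω) '' T))) P ∧
    Tendsto (fun k => ∫ ω, Real.exp (Finset.univ.sup' Finset.univ_nonempty
      fun s : N k => χ s ω) ∂P) atTop (𝓝 (HalphaSet P χ T)) := by
  have hM := fun ω => tendsto_sup'_dyadic_nets hT hTne hNT hN (hχ.cont ω)
  have hmeas : ∀ k, Measurable fun ω => Real.exp (Finset.univ.sup' Finset.univ_nonempty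
      fun s : N k => χ s ω) :=
    fun k => (Finset.measurable_univ_sup' fun s => hχ.meas _).exp
  have hlim : ∀ ω, Tendsto (fun k => Real.exp (Finset.univ.sup' Finset.univ_nonempty
      fun s : N k => χ s ω)) atTop (𝓝 (Real.exp (sSup ((fun t => χ t ω) '' T)))) :=
    fun ω => (Real.continuous_exp.tendsto _).comp (hM ω).2
  have hmeas' : Measurable fun ω => Real.exp (sSup ((fun t => χ t ω) '' T)) :=
    measurable_of_tendsto_metrizable hmeas (tendsto_pi_nhds.2 hlim)
  have hInt : Integrable (fun ω => Real.exp (sSup ((fun t => χ t ω) '' T))) P := by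
    refine ⟨hmeas'.aestronglyMeasurable, ?_⟩
    rw [hasFiniteIntegral_iff_ofReal (.of_forall fun ω => (Real.exp_pos _).le)]
    refine lt_of_le_of_lt ?_ (ENNReal.ofReal_lt_top (r := C))
    calc ∫⁻ ω, ENNReal.ofReal (Real.exp (sSup ((fun t => χ t ω) '' T))) ∂P
        = ∫⁻ ω, liminf (fun k => ENNReal.ofReal (Real.exp (Finset.univ.sup' Finset.univ_nonempty
            fun s : N k => χ s ω))) atTop ∂P :=
          lintegral_congr fun ω =>
            ((ENNReal.continuous_ofReal.tendsto _).comp (hlim ω)).liminf_eq.symm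
      _ ≤ liminf (fun k => ∫⁻ ω, ENNReal.ofReal (Real.exp
            (Finset.univ.sup' Finset.univ_nonempty fun s : N k => χ s ω)) ∂P) atTop :=
          lintegral_liminf_le fun k => (hmeas k).ennreal_ofReal
      _ ≤ ENNReal.ofReal C := by
          refine (liminf_le_liminf (.of_forall fun k => ?_)).trans_eq
            (liminf_const (f := (atTop : Filter ℕ)) _)
          rw [← ofReal_integral_eq_lintegral_ofReal (hχ.integrable_exp_sup _)
            (.of_forall fun ω => (Real.exp_pos _).le)]
          exact ENNReal.ofReal_le_ofReal (hC k)
  refine ⟨hInt, ?_⟩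
  refine tendsto_integral_of_dominated_convergence _ (fun k => (hmeas k).aestronglyMeasurable)
    hInt (fun k => .of_forall fun ω => ?_) (.of_forall hlim)
  rw [Real.norm_of_nonneg (Real.exp_pos _).le]
  exact Real.exp_le_exp.2 ((hM ω).1 k)

/-- A squeeze principle for families of upper and lower bounds. -/
lemma tendsto_of_approximations {β : Type*} {l : Filter β} {p : β → ℝ} {g h : ℕ → β → ℝ}
    {G H ε : ℕ → ℝ} {a : ℝ} (hup : ∀ᶠ m in atTop, ∀ᶠ u in l, p u ≤ g m u + ε m)
    (hg : ∀ m, Tendsto (g m) l (𝓝 (G m))) (hlow : ∀ m, ∀ᶠ u in l, h m u ≤ p u)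
    (hh : ∀ m, Tendsto (h m) l (𝓝 (H m))) (hH : Tendsto H atTop (𝓝 a))
    (hG : Tendsto (fun m => G m + ε m) atTop (𝓝 a)) : Tendsto p l (𝓝 a) := by
  refine tendsto_order.2 ⟨fun b hb => ?_, fun b hb => ?_⟩
  · obtain ⟨m, hm⟩ := (hH.eventually_const_lt hb).exists
    filter_upwards [hlow m, (hh m).eventually_const_lt hm] with u h1 h2 using h2.trans_le h1
  · obtain ⟨m, hm, hm'⟩ := ((hG.eventually_lt_const hb).and hup).exists
    filter_upwards [hm', ((hg m).add_const (ε m)).eventually_lt_const hm] with u h1 h2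
      using h1.trans_lt h2

/-- Lemma 6.1 of Piterbarg: Let `X` be a centered homogeneous Gaussian
field on `ℝ^n` with covariance `r(t) = 1 − ‖t‖^α + o(‖t‖^α)` as `‖t‖ → 0` (`0 < α ≤ 2`).
Then for every nonempty compact `T ⊂ ℝ^n`,
`P(sup_{t ∈ u^{−2/α}T} X(t) > u) = Ψ(u) H_α(T) (1 + o(1))` as `u → ∞`,
i.e. the ratio tends to `1`; the event `sup_{t∈u^{−2/α}T} X > u` is `∃ t ∈ T, X(u^{−2/α}t) > u`. -/
theorem stmt4 (n : ℕ) (hn : 1 ≤ n) (α : ℝ) (hα0 : 0 < α) (hα2 : α ≤ 2)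
    {Ω : Type*} [MeasurableSpace Ω] (P : Measure Ω) [IsProbabilityMeasure P]
    (X : EuclideanSpace ℝ (Fin n) → Ω → ℝ) (r : EuclideanSpace ℝ (Fin n) → ℝ)
    (hX : IsHomogGaussianField P X r)
    (hrα : (fun t => r t - (1 - ‖t‖ ^ α))
      =o[𝓝 0] fun t : EuclideanSpace ℝ (Fin n) => ‖t‖ ^ α)
    {Ω' : Type*} [MeasurableSpace Ω'] (P' : Measure Ω') [IsProbabilityMeasure P']
    (χ : EuclideanSpace ℝ (Fin n) → Ω' → ℝ) (hχ : IsChiAlpha P' α χ)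
    (T : Set (EuclideanSpace ℝ (Fin n))) (hT : IsCompact T) (hTne : T.Nonempty) :
    Tendsto (fun u : ℝ =>
        (P {ω | ∃ t ∈ T, u < X (u ^ (-2 / α) • t) ω}).toReal / (PsiFn u * HalphaSet P' χ T))
      atTop (𝓝 1) := by
  obtain ⟨N, D, K, hD, hK, hNT, hcard, hN⟩ := hT.isBounded.exists_dyadic_nets hTne
  have hne : ∀ k, Nonempty (N k) := fun k => by
    obtain ⟨t, ht⟩ := hTne
    obtain ⟨s, hs, -⟩ := hN k t ht
    exact ⟨⟨s, hs⟩⟩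
  have hn0 : (0 : ℝ) < √n := Real.sqrt_pos.2 (by exact_mod_cast hn)
  have hρ1 : (1 / 2 : ℝ) ^ α < 1 := Real.rpow_lt_one (by norm_num) (by norm_num) hα0
  obtain ⟨δ, hδ0, hδ1, hδ, hκδ, hsum⟩ := exists_chaining_levels
    (C := 2 * (2 * √n) ^ α) (ρ := (1 / 2 : ℝ) ^ α) (by positivity) (by positivity) hρ1
    (B := K ^ 2) (one_le_pow₀ hK)
  set κ : ℕ → ℝ := fun k => 2 * (2 * √n) ^ α * ((1 / 2 : ℝ) ^ α) ^ k with hκ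
  set w : ℕ → ℝ := fun k => D ^ 2 * K * Real.exp 1 *
    ((K ^ 2) ^ k * Real.exp (-(δ k - δ (k + 1)) ^ 2 / (16 * κ k))) with hw
  have hws : Summable w := hsum.mul_left _
  have hK0 : 0 < K := by linarith
  have hcw : ∀ k, (N k).card * (N (k + 1)).card *
      (Real.exp 1 * Real.exp (-(δ k - δ (k + 1)) ^ 2 / (16 * κ k))) ≤ w k := fun k =>
    calc (N k).card * (N (k + 1)).card *
          (Real.exp 1 * Real.exp (-(δ k - δ (k + 1)) ^ 2 / (16 * κ k)))
        ≤ (D * K ^ k) * (D * K ^ (k + 1)) *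
          (Real.exp 1 * Real.exp (-(δ k - δ (k + 1)) ^ 2 / (16 * κ k))) := by
          gcongr
          · exact hcard k
          · exact hcard (k + 1)
      _ = w k := by simp only [hw]; ring
  have hκb : ∀ k, 2 * (2 * √n * (1 / 2) ^ k) ^ α ≤ κ k := fun k => by
    rw [Real.mul_rpow (by positivity) (by positivity), ← Real.rpow_natCast (1 / 2 : ℝ) k,
      ← Real.rpow_mul (by norm_num), mul_comm (k : ℝ) α, Real.rpow_mul (by norm_num),
      Real.rpow_natCast, ← mul_assoc]
  obtain ⟨m₀, hm₀⟩ := eventually_atTop.1 hκδ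
  set H : ℕ → ℝ := fun k => ∫ ω, Real.exp (Finset.univ.sup' Finset.univ_nonempty
    fun s : N k => χ s ω) ∂P' with hH
  set p : ℝ → ℝ := fun u => P.real {ω | ∃ t ∈ T, u < X (u ^ (-2 / α) • t) ω} / PsiFn u with hp
  set g : ℝ → ℕ → ℝ → ℝ := fun d m u => P.real {ω | ∃ s : N m,
    u - d / u < X (u ^ (-2 / α) • (s : EuclideanSpace ℝ (Fin n))) ω} / PsiFn u with hg
  have hup : ∀ m, m₀ ≤ m → ∀ᶠ u in atTop, p u ≤ g (δ m) m u + ∑' j, w (j + m) := fun m hm =>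
    hX.eventually_measureReal_exists_div_PsiFn_le hα0 hrα hn0.le hN hδ0 hδ1 hκb
      (fun k hk => hm₀ k (hm.trans hk)) hws hcw
  have hglim : ∀ d m, Tendsto (g d m) atTop (𝓝 (Real.exp d * H m)) := fun d m => by
    have h := hX.tendsto_measureReal_exists_div_PsiFn hα0 hrα hχ
      (fun s : N m => (s : EuclideanSpace ℝ (Fin n))) d
    convert h using 2
    rw [hH, ← integral_const_mul]
    refine integral_congr_ae (.of_forall fun ω => ?_)
    simp only
    rw [← Real.exp_add, add_comm, Finset.sup'_add]
  have hglim0 : ∀ m, Tendsto (g 0 m) atTop (𝓝 (H m)) := fun m => by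
    have h := hglim 0 m
    rwa [Real.exp_zero, one_mul] at h
  have hlow : ∀ m, ∀ᶠ u in atTop, g 0 m u ≤ p u := fun m => by
    filter_upwards [eventually_gt_atTop 0] with u hu
    refine div_le_div_of_nonneg_right (measureReal_mono ?_) (PsiFn_pos hu).le
    rintro ω ⟨s, hs⟩
    exact ⟨s, hNT m s s.2, by simpa using hs⟩
  have hbdd : ∀ k, H k ≤ Real.exp (δ m₀) * H m₀ + ∑' j, w (j + m₀) := fun k => by
    refine le_of_tendsto_of_tendsto (hglim0 k)
      ((hglim (δ m₀) m₀).add_const _) ?_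
    filter_upwards [hlow k, hup m₀ le_rfl] with u h1 h2 using h1.trans h2
  obtain ⟨hInt, hHlim⟩ := hχ.tendsto_integral_exp_sup hT hTne hNT hN hbdd
  have hplim : Tendsto p atTop (𝓝 (HalphaSet P' χ T)) := by
    refine tendsto_of_approximations (ε := fun m => ∑' j, w (j + m)) (eventually_atTop.2 ⟨m₀, hup⟩)
      (fun m => hglim (δ m) m) hlow hglim0 hHlim ?_
    have h1 := ((Real.continuous_exp.tendsto 0).comp hδ).mul hHlim
    have h2 := h1.add (tendsto_sum_nat_add w)
    rwa [Real.exp_zero, one_mul, add_zero] at h2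
  have hpos : 0 < HalphaSet P' χ T := integral_exp_pos hInt
  have := hplim.div_const (HalphaSet P' χ T)
  rw [div_self hpos.ne'] at this
  refine this.congr fun u => ?_
  rw [hp, div_div, measureReal_def]
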